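/- There exist absolute constants 0 < c₁ < c₂ and x₀ such that the following holds. Let x ≥ x₀, let 1 ≤ y ≤ x, and let k be a positive integer with k ≤ 10·(Log₂ x − Log₂ y); set t := k/(Log₂ x − Log₂ y). Then c₁ · exp(−(Log₂ x − Log₂ y)·Q(t))/√k ≤ ∏_{y ≤ p < x}(1 + 1/p)^{-1} · ∑_{n ∈ S_{[y,x)}, ω(n) = k} 1/n ≤ c₂ · exp(−(Log₂ x − Log₂ y)·Q(t))/√k, where Q(t) := t·log t − t + 1. -/

import Mathlib

open Filter Topology
open scoped Classical

noncomputable def LLog (x : ℝ) : ℝ := max 1 (Real.log x)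
noncomputable def LLog2 (x : ℝ) : ℝ := LLog (LLog x)
noncomputable def LLog3 (x : ℝ) : ℝ := LLog (LLog2 x)

/-- `Δ^{(v)}(n)`: the maximal number of divisors of `n` in an interval `(e^u, e^{u+v}]`. -/
noncomputable def DeltaV (v : ℝ) (n : ℕ) : ℕ :=
  ⨆ u : ℝ, (n.divisors.filter fun d => Real.exp u < (d : ℝ) ∧ (d : ℝ) ≤ Real.exp (u + v)).card

/-- The Erdős–Hooley Delta function. -/
noncomputable def Delta (n : ℕ) : ℕ := DeltaV 1 n

/-- `S_{[y,x)}`: squarefree positive integers all of whose prime factors `p` satisfy `y ≤ p < x`. -/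
def Sset (y x : ℝ) : Set ℕ :=
  {n | 0 < n ∧ Squarefree n ∧ ∀ p ∈ n.primeFactors, y ≤ (p : ℝ) ∧ (p : ℝ) < x}

/-- `∏_{y ≤ p < x} (1 + 1/p)⁻¹`, product over primes. -/
noncomputable def primeProd (y x : ℝ) : ℝ :=
  ∏ᶠ p ∈ {p : ℕ | p.Prime ∧ y ≤ (p : ℝ) ∧ (p : ℝ) < x}, ((1 : ℝ) + 1 / p)⁻¹

/-- number of distinct prime factors -/
def omegaN (n : ℕ) : ℕ := n.primeFactors.card

/-- number of divisors -/
def tauN (n : ℕ) : ℕ := n.divisors.card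

/-- `n_{<y}`: the largest divisor of `n` (squarefree) composed of primes `< y`. -/
noncomputable def nsmall (n : ℕ) (y : ℝ) : ℕ :=
  ∏ p ∈ n.primeFactors.filter (fun p : ℕ => (p : ℝ) < y), p

def Yset (α x : ℝ) : Set ℝ :=
  {y | 0 < y ∧ |LLog2 y - α * LLog2 x| ≤ Real.sqrt (LLog2 x) ∧ ∃ m : ℤ, LLog2 y = m * Real.log 2}

def Uset (α x : ℝ) : Set ℤ :=
  {u | |(u : ℝ) - (Real.log 4 - 1) / Real.log 2 * (α * LLog2 x)| ≤ Real.sqrt (LLog2 x)}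

noncomputable def Qfun (t : ℝ) : ℝ := t * Real.log t - t + 1

noncomputable def mA (n : ℕ) : ℝ := ∑ p ∈ (Finset.range (n+1)).filter Nat.Prime, Real.log p / p

lemma log_fact (n : ℕ) : Real.log (n.factorial) =
    ∑ p ∈ (Finset.range (n+1)).filter Nat.Prime, (n.factorial.factorization p : ℝ) * Real.log p := by
  have h0 : n.factorial ≠ 0 := Nat.factorial_ne_zero n
  have h := Nat.prod_factorization_pow_eq_self h0
  have h2 : (n.factorial.factorization).prod (fun p k => p ^ k) =
      ∏ p ∈ (Finset.range (n+1)).filter Nat.Prime, p ^ (n.factorial.factorization p) := by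
    apply Finsupp.prod_of_support_subset
    · intro p hp
      rw [Nat.support_factorization] at hp
      have hp' := Nat.prime_of_mem_primeFactors hp
      have := (hp'.dvd_factorial).1 (Nat.dvd_of_mem_primeFactors hp)
      simp only [Finset.mem_filter, Finset.mem_range]
      exact ⟨by omega, hp'⟩
    · simp
  rw [h2] at h
  conv_lhs => rw [← h]
  push_cast
  rw [Real.log_prod]
  · apply Finset.sum_congr rfl
    intro p _
    rw [Real.log_pow]
  · intro p hp
    have := (Finset.mem_filter.1 hp).2.pos
    positivity

lemma vp_lower (n p : ℕ) (hp : p.Prime) : (n : ℝ) / p - 1 ≤ n.factorial.factorization p := by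
  have := Fact.mk hp
  rw [Nat.factorization_def _ hp]
  have h1 : n / p ≤ padicValNat p (n.factorial) := by
    have h2 := padicValNat_factorial_mul (p := p) (n / p)
    have h3 : padicValNat p (p * (n / p)).factorial ≤ padicValNat p n.factorial := by
      apply (padicValNat_dvd_iff_le (Nat.factorial_ne_zero n)).1
      exact pow_padicValNat_dvd.trans (Nat.factorial_dvd_factorial (Nat.mul_div_le n p))
    omega
  have h4 : (n : ℝ) / p < (n / p : ℕ) + 1 := by
    have := hp.pos
    rw [div_lt_iff₀ (by positivity)]
    have := Nat.lt_div_mul_add hp.pos (a := n)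
    have h : n < (n / p + 1) * p := by linarith
    exact_mod_cast h
  have h5 : ((n / p : ℕ) : ℝ) ≤ padicValNat p (n.factorial) := by exact_mod_cast h1
  linarith

lemma vp_upper (n p : ℕ) (hp : p.Prime) : (n.factorial.factorization p : ℝ) ≤ n / ((p:ℝ) - 1) := by
  have := Fact.mk hp
  rw [Nat.factorization_def _ hp]
  have h2 := sub_one_mul_padicValNat_factorial (p := p) n
  have h1 : (p - 1) * padicValNat p n.factorial ≤ n := by omega
  have h3 : (((p - 1 : ℕ) : ℝ)) * padicValNat p n.factorial ≤ n := by exact_mod_cast h1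
  have := hp.two_le
  rw [Nat.cast_sub hp.one_le] at h3
  have h4 : (2:ℝ) ≤ p := by exact_mod_cast this
  rw [le_div_iff₀ (by linarith)]
  push_cast at h3
  linarith

lemma mertens1 : ∃ C : ℝ, 0 < C ∧ ∀ n : ℕ, 1 ≤ n → |mA n - Real.log n| ≤ C := by
  have hs : Summable (fun n : ℕ => 1 / (n : ℝ) ^ (3/2 : ℝ)) := by
    apply Real.summable_one_div_nat_rpow.2; norm_num
  set T := ∑' n : ℕ, 1 / (n : ℝ) ^ (3/2 : ℝ) with hT
  have hT0 : 0 ≤ T := tsum_nonneg (fun n => by positivity)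
  refine ⟨Real.log 4 + 4 * T + 1, by have := Real.log_pos (show (1:ℝ) < 4 by norm_num); linarith, ?_⟩
  intro n hn
  have hn0 : (0:ℝ) < n := by exact_mod_cast hn
  have hl4 := Real.log_pos (show (1:ℝ) < 4 by norm_num)
  have hub : Real.log n.factorial ≤ n * Real.log n := by
    rw [← Real.log_pow]
    apply Real.log_le_log (by exact_mod_cast Nat.factorial_pos n)
    exact_mod_cast Nat.factorial_le_pow n
  have hlb : n * Real.log n - n ≤ Real.log n.factorial := by
    have := Stirling.le_log_factorial_stirling (n := n) (by omega)
    have h1 : 0 ≤ Real.log n := Real.log_natCast_nonneg n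
    have h2 : 0 ≤ Real.log (2 * Real.pi) := Real.log_nonneg (by have := Real.pi_gt_three; linarith)
    linarith
  rw [log_fact] at hub hlb
  rw [abs_le]
  constructor
  · have h1 : ∑ p ∈ (Finset.range (n+1)).filter Nat.Prime, (n.factorial.factorization p : ℝ) * Real.log p
        ≤ ∑ p ∈ (Finset.range (n+1)).filter Nat.Prime, (n * (Real.log p / p) + n * (4 * (1 / (p : ℝ) ^ (3/2 : ℝ)))) := by
      apply Finset.sum_le_sum
      intro p hp
      have hp := (Finset.mem_filter.1 hp).2
      have h2 : (2:ℝ) ≤ p := by exact_mod_cast hp.two_le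
      have hlp : 0 ≤ Real.log p := Real.log_natCast_nonneg p
      have h3 := mul_le_mul_of_nonneg_right (vp_upper n p hp) hlp
      refine h3.trans ?_
      have h4 : Real.log p ≤ 2 * (p:ℝ) ^ (1/2 : ℝ) := by
        have := Real.log_le_rpow_div (x := p) (by positivity) (show (0:ℝ) < 1/2 by norm_num)
        linarith
      have h5 : (p:ℝ) ^ (3/2 : ℝ) = p * (p:ℝ) ^ (1/2 : ℝ) := by
        rw [← Real.rpow_one_add' (by positivity) (by norm_num)]; norm_num
      have h6 : (p:ℝ) ^ (1/2 : ℝ) * (p:ℝ) ^ (1/2 : ℝ) = p := by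
        rw [← Real.rpow_add (by positivity)]; norm_num
      have hq : 0 < (p:ℝ) ^ (1/2 : ℝ) := by positivity
      rw [h5]
      set q := (p:ℝ) ^ (1/2 : ℝ)
      have h7 : Real.log p / (p - 1) ≤ Real.log p / p + 4 * (1 / (p * q)) := by
        have : Real.log p / (p - 1) = Real.log p / p + Real.log p / (p * (p - 1)) := by
          have : (p:ℝ) - 1 ≠ 0 := by linarith
          field_simp; ring
        rw [this]
        gcongr
        rw [div_le_iff₀ (by nlinarith)]
        have : 4 * (1 / (p * q)) * (p * ((p:ℝ) - 1)) = 4 * (p - 1) / q := by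
          field_simp
        rw [this, le_div_iff₀ hq]
        nlinarith
      calc (n:ℝ) / (p - 1) * Real.log p = n * (Real.log p / (p - 1)) := by ring
        _ ≤ n * (Real.log p / p + 4 * (1 / (p * q))) := by gcongr
        _ = _ := by ring
    rw [Finset.sum_add_distrib, ← Finset.mul_sum, ← Finset.mul_sum, ← Finset.mul_sum] at h1
    have h8 := hs.sum_le_tsum ((Finset.range (n+1)).filter Nat.Prime) (fun n _ => by positivity)
    rw [← hT] at h8
    have h9 : (n:ℝ) * Real.log n ≤ n * (mA n + 4 * T + 1) := by
      unfold mA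
      have := mul_le_mul_of_nonneg_left h8 hn0.le
      linarith
    have := le_of_mul_le_mul_left h9 hn0
    linarith
  · have h1 : ∑ p ∈ (Finset.range (n+1)).filter Nat.Prime, (n * (Real.log p / p) - Real.log p) ≤ ∑ p ∈ (Finset.range (n+1)).filter Nat.Prime, (n.factorial.factorization p : ℝ) * Real.log p := by
      apply Finset.sum_le_sum
      intro p hp
      have hp := (Finset.mem_filter.1 hp).2
      have hlp : 0 ≤ Real.log p := Real.log_natCast_nonneg p
      have h3 := mul_le_mul_of_nonneg_right (vp_lower n p hp) hlp
      refine le_trans (le_of_eq ?_) h3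
      ring
    rw [Finset.sum_sub_distrib, ← Finset.mul_sum] at h1
    have h2 : ∑ p ∈ (Finset.range (n+1)).filter Nat.Prime, Real.log p ≤ Real.log 4 * n := by
      have := Chebyshev.theta_le_log4_mul_x (x := n) (by positivity)
      rw [Chebyshev.theta_eq_sum_Icc, Nat.floor_natCast] at this
      rwa [Nat.range_succ_eq_Icc_zero]
    have h9 : n * mA n ≤ n * (Real.log n + Real.log 4) := by
      unfold mA
      linarith
    have := le_of_mul_le_mul_left h9 hn0
    linarith

noncomputable def mP (n : ℕ) : ℝ := ∑ p ∈ (Finset.range (n+1)).filter Nat.Prime, 1 / (p : ℝ)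

lemma mP_step (b : ℕ) (hb : 2 ≤ b) :
    mP (b+1) - mP b = (mA (b+1) - mA b) / Real.log (b+1 : ℕ) := by
  have hl : 0 < Real.log (b+1 : ℕ) := Real.log_pos (by exact_mod_cast (by omega : 1 < b + 1))
  unfold mP mA
  rw [Finset.range_add_one (n := b+1), Finset.filter_insert]
  split_ifs with h
  · rw [Finset.sum_insert (by simp), Finset.sum_insert (by simp)]
    have : (0:ℝ) < (b+1 : ℕ) := by positivity
    field_simp
    ring
  · simp

lemma log_ratio {u v : ℝ} (hv : 0 < v) (huv : v ≤ u) (h1 : u - v ≤ 1) :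
    0 ≤ (Real.log u - Real.log v) - (u - v) / u ∧
    (Real.log u - Real.log v) - (u - v) / u ≤ 1 / v - 1 / u := by
  have hu : 0 < u := by linarith
  rw [← Real.log_div hu.ne' hv.ne']
  have h2 := Real.one_sub_inv_le_log_of_pos (x := u / v) (by positivity)
  have h3 := Real.log_le_sub_one_of_pos (x := u / v) (by positivity)
  have e1 : 1 - (u / v)⁻¹ = (u - v) / u := by field_simp
  have e2 : u / v - 1 = (u - v) / v := by field_simp
  constructor
  · linarith
  · have : (u - v) / v - (u - v) / u ≤ 1 / v - 1 / u := by
      have e3 : (u - v) / v - (u - v) / u = (u - v) * (1 / v - 1 / u) := by ring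
      have : 0 ≤ 1 / v - 1 / u := by
        have := one_div_le_one_div_of_le hv huv
        linarith
      rw [e3]
      nlinarith
    linarith

lemma log_succ_sub {b : ℝ} (hb : 1 ≤ b) : Real.log (b + 1) - Real.log b ≤ 1 := by
  rw [← Real.log_div (by linarith) (by linarith)]
  have h3 := Real.log_le_sub_one_of_pos (x := (b+1) / b) (by positivity)
  have : (b+1)/b - 1 = 1 / b := by field_simp; ring
  have : 1 / b ≤ 1 := by rw [div_le_one (by linarith)]; exact hb
  linarith

lemma mertens2_nat : ∃ C : ℝ, 0 < C ∧ ∀ a b : ℕ, 2 ≤ a → a ≤ b →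
    |mP b - mP a - (Real.log (Real.log b) - Real.log (Real.log a))| ≤ C / Real.log a := by
  obtain ⟨C, hC, hA⟩ := mertens1
  refine ⟨4 * C + 1, by linarith, ?_⟩
  intro a b ha hab
  have key : |mP b - mP a - (Real.log (Real.log b) - Real.log (Real.log a))
      - ((mA b - Real.log b) - (mA a - Real.log a)) / Real.log b| ≤
        (2 * C + 1) * (1 / Real.log a - 1 / Real.log b) := by
    induction b, hab using Nat.le_induction with
    | base => simp
    | succ b hab ih =>
      have hb2 : 2 ≤ b := by omega
      have hb2' : (2:ℝ) ≤ b := by exact_mod_cast hb2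
      have hs := mP_step b hb2
      have hv : 0 < Real.log b := Real.log_pos (by linarith)
      have huv : Real.log b ≤ Real.log (b+1 : ℕ) := Real.log_le_log (by linarith) (by push_cast; linarith)
      have h1 : Real.log (b+1 : ℕ) - Real.log b ≤ 1 := by
        push_cast; exact log_succ_sub (by linarith)
      obtain ⟨l1, l2⟩ := log_ratio hv huv h1
      have hRb := abs_le.1 (hA b (by omega))
      have hRa := abs_le.1 (hA a (by omega))
      set u := Real.log (b+1 : ℕ)
      set v := Real.log b
      have hu : 0 < u := by linarith
      have hinv : 0 ≤ 1 / v - 1 / u := by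
        have := one_div_le_one_div_of_le hv huv
        linarith
      set Rb := mA b - v with hRbd
      set Ra := mA a - Real.log a
      have e1 : mP (b+1) - mP a - (Real.log u - Real.log (Real.log a)) - ((mA (b+1) - u) - Ra) / u
        = (mP b - mP a - (Real.log v - Real.log (Real.log a)) - (Rb - Ra) / v)
          - ((Real.log u - Real.log v) - (u - v) / u) + (Rb - Ra) * (1 / v - 1 / u) := by
        have : mP (b+1) = mP b + (mA (b+1) - mA b) / u := by linarith
        rw [this, hRbd]
        field_simp
        ring
      rw [e1]
      have ih' := abs_le.1 ih
      have m1 : (Rb - Ra) * (1 / v - 1 / u) ≤ 2 * C * (1 / v - 1 / u) :=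
        mul_le_mul_of_nonneg_right (by linarith) hinv
      have m2 : -(2 * C) * (1 / v - 1 / u) ≤ (Rb - Ra) * (1 / v - 1 / u) :=
        mul_le_mul_of_nonneg_right (by linarith) hinv
      rw [abs_le]
      constructor <;> nlinarith
  have ha2' : (2:ℝ) ≤ a := by exact_mod_cast ha
  have hab' : (a:ℝ) ≤ b := by exact_mod_cast hab
  have hv : 0 < Real.log a := Real.log_pos (by linarith)
  have huv : Real.log a ≤ Real.log b := Real.log_le_log (by linarith) hab'
  have hRb := abs_le.1 (hA b (by omega))
  have hRa := abs_le.1 (hA a (by omega))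
  have hu : 0 < Real.log b := by linarith
  have h3 : |((mA b - Real.log b) - (mA a - Real.log a)) / Real.log b| ≤ 2 * C * (1 / Real.log b) := by
    rw [abs_div, abs_of_pos hu, div_eq_mul_one_div]
    gcongr
    rw [abs_le]; constructor <;> linarith
  have h4 := one_div_le_one_div_of_le hv huv
  have h5 : 0 < 1 / Real.log b := by positivity
  rw [div_eq_mul_one_div]
  have k1 := abs_le.1 key
  have k2 := abs_le.1 h3
  rw [abs_le]
  have : C * (1 / Real.log b) ≤ C * (1 / Real.log a) := by gcongr
  have : (2 * C + 1) * (1 / Real.log a - 1 / Real.log b) + 2 * C * (1 / Real.log b) ≤ (4 * C + 1) * (1 / Real.log a) := by nlinarith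
  constructor <;> linarith

noncomputable def PS (y x : ℝ) : Finset ℕ :=
  (Finset.range ⌈x⌉₊).filter (fun p => p.Prime ∧ y ≤ (p : ℝ))

lemma mem_PS {y x : ℝ} {p : ℕ} : p ∈ PS y x ↔ p.Prime ∧ y ≤ (p:ℝ) ∧ (p:ℝ) < x := by
  unfold PS
  rw [Finset.mem_filter, Finset.mem_range, Nat.lt_ceil]
  tauto

noncomputable def LS (y x : ℝ) : ℝ := ∑ p ∈ PS y x, 1 / (p : ℝ)

lemma LS_nonneg (y x : ℝ) : 0 ≤ LS y x := Finset.sum_nonneg (fun p _ => by positivity)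

lemma LS_add {y z x : ℝ} (h1 : y ≤ z) (h2 : z ≤ x) : LS y x = LS y z + LS z x := by
  unfold LS
  rw [← Finset.sum_union]
  · apply Finset.sum_congr _ (fun _ _ => rfl)
    ext p
    simp only [Finset.mem_union, mem_PS]
    constructor
    · rintro ⟨a, b, c⟩
      rcases lt_or_ge (p:ℝ) z with h | h
      · left; exact ⟨a, b, h⟩
      · right; exact ⟨a, h, c⟩
    · rintro (⟨a, b, c⟩ | ⟨a, b, c⟩)
      · exact ⟨a, b, by linarith⟩
      · exact ⟨a, by linarith, c⟩
  · rw [Finset.disjoint_left]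
    intro p hp hq
    rw [mem_PS] at hp hq
    linarith [hp.2.2, hq.2.1]

lemma LS_one (x : ℝ) (hx : 0 < x) : LS 1 x = mP (⌈x⌉₊ - 1) := by
  have : 0 < ⌈x⌉₊ := Nat.ceil_pos.2 hx
  unfold LS mP PS
  rw [Nat.sub_add_cancel this]
  apply Finset.sum_congr _ (fun _ _ => rfl)
  apply Finset.filter_congr
  intro p _
  constructor
  · exact fun h => h.1
  · exact fun h => ⟨h, by exact_mod_cast h.one_le⟩

lemma loglog_ceil (y : ℝ) (hy : 3 ≤ y) : 2 ≤ ⌈y⌉₊ - 1 ∧ Real.log y / 2 ≤ Real.log ((⌈y⌉₊ - 1 : ℕ)) ∧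
    |Real.log (Real.log y) - Real.log (Real.log (⌈y⌉₊ - 1 : ℕ))| ≤ 2 / Real.log y := by
  have h1 : y ≤ ⌈y⌉₊ := Nat.le_ceil y
  have h2 : (⌈y⌉₊ : ℝ) < y + 1 := Nat.ceil_lt_add_one (by linarith)
  have h3 : 3 ≤ ⌈y⌉₊ := by
    have : (3:ℝ) ≤ ⌈y⌉₊ := by linarith
    exact_mod_cast this
  have h4 : ((⌈y⌉₊ - 1 : ℕ) : ℝ) = ⌈y⌉₊ - 1 := by rw [Nat.cast_sub (by omega)]; simp
  have h5 : 2 ≤ ⌈y⌉₊ - 1 := by omega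
  have h5' : (2:ℝ) ≤ (⌈y⌉₊ - 1 : ℕ) := by exact_mod_cast h5
  set a : ℝ := ((⌈y⌉₊ - 1 : ℕ) : ℝ)
  have ha1 : a < y := by linarith
  have ha2 : y ≤ a + 1 := by linarith
  have hly : 0 < Real.log y := Real.log_pos (by linarith)
  have hla : 0 < Real.log a := Real.log_pos (by linarith)
  have h6 : Real.log y / 2 ≤ Real.log a := by
    have : Real.log y ≤ Real.log (a ^ 2) := Real.log_le_log (by linarith) (by nlinarith)
    rw [Real.log_pow] at this
    push_cast at this
    linarith
  refine ⟨h5, h6, ?_⟩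
  have h7 : Real.log a ≤ Real.log y := Real.log_le_log (by linarith) ha1.le
  have h8 : Real.log y - Real.log a ≤ 1 := by
    have := log_succ_sub (b := a) (by linarith)
    have : Real.log y ≤ Real.log (a + 1) := Real.log_le_log (by linarith) ha2
    linarith
  have h9 := Real.log_le_log hla h7
  rw [abs_of_nonneg (by linarith), ← Real.log_div hly.ne' hla.ne']
  have h10 := Real.log_le_sub_one_of_pos (x := Real.log y / Real.log a) (by positivity)
  have e : Real.log y / Real.log a - 1 = (Real.log y - Real.log a) / Real.log a := by field_simp
  rw [e] at h10
  refine h10.trans ?_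
  rw [div_le_div_iff₀ hla hly]
  nlinarith

lemma mertens2 : ∃ C : ℝ, 0 < C ∧ ∀ y x : ℝ, 3 ≤ y → y ≤ x →
    |LS y x - (Real.log (Real.log x) - Real.log (Real.log y))| ≤ C / Real.log y := by
  obtain ⟨C, hC, h⟩ := mertens2_nat
  refine ⟨2 * C + 4, by linarith, ?_⟩
  intro y x hy hyx
  have h1 := LS_add (y := 1) (by linarith : (1:ℝ) ≤ y) hyx
  rw [LS_one x (by linarith), LS_one y (by linarith)] at h1
  obtain ⟨a1, a2, a3⟩ := loglog_ceil y hy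
  obtain ⟨b1, b2, b3⟩ := loglog_ceil x (by linarith)
  have hab : ⌈y⌉₊ - 1 ≤ ⌈x⌉₊ - 1 := Nat.sub_le_sub_right (Nat.ceil_mono hyx) 1
  have h2 := h _ _ a1 hab
  set a := ⌈y⌉₊ - 1
  set b := ⌈x⌉₊ - 1
  have hly : 0 < Real.log y := Real.log_pos (by linarith)
  have hlx : Real.log y ≤ Real.log x := Real.log_le_log (by linarith) hyx
  have h3 : C / Real.log a ≤ 2 * C / Real.log y := by
    rw [div_le_div_iff₀ (by linarith) hly]
    nlinarith
  have h4 : 2 / Real.log x ≤ 2 / Real.log y := by gcongr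
  have e : (2 * C + 4) / Real.log y = 2 * C / Real.log y + 2 / Real.log y + 2 / Real.log y := by ring
  rw [e]
  have := abs_le.1 h2
  have := abs_le.1 a3
  have := abs_le.1 b3
  rw [abs_le]
  constructor <;> linarith

noncomputable def EE (w : ℕ → ℝ) (S : Finset ℕ) (k : ℕ) : ℝ := ∑ A ∈ S.powersetCard k, ∏ i ∈ A, w i

lemma EE_zero (w : ℕ → ℝ) (S : Finset ℕ) : EE w S 0 = 1 := by simp [EE]

lemma EE_insert (w : ℕ → ℝ) (S : Finset ℕ) (a : ℕ) (ha : a ∉ S) (k : ℕ) :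
    EE w (insert a S) (k+1) = EE w S (k+1) + w a * EE w S k := by
  unfold EE
  rw [Finset.powersetCard_succ_insert ha, Finset.sum_union, Finset.sum_image, Finset.mul_sum]
  · congr 1
    apply Finset.sum_congr rfl
    intro A hA
    rw [Finset.prod_insert]
    exact fun h => ha ((Finset.mem_powersetCard.1 hA).1 h)
  · intro A hA B hB h
    have hA' : a ∉ A := fun h => ha ((Finset.mem_powersetCard.1 hA).1 h)
    have hB' : a ∉ B := fun h => ha ((Finset.mem_powersetCard.1 hB).1 h)
    rw [← Finset.erase_insert hA', ← Finset.erase_insert hB', h]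
  · rw [Finset.disjoint_left]
    intro A hA hB
    obtain ⟨B, _, rfl⟩ := Finset.mem_image.1 hB
    exact ha ((Finset.mem_powersetCard.1 hA).1 (Finset.mem_insert_self _ _))

lemma EE_nonneg (w : ℕ → ℝ) (hw : ∀ i, 0 ≤ w i) (S : Finset ℕ) (k : ℕ) : 0 ≤ EE w S k :=
  Finset.sum_nonneg (fun _ _ => Finset.prod_nonneg (fun i _ => hw i))

lemma EE_empty (w : ℕ → ℝ) (k : ℕ) : EE w ∅ (k+1) = 0 := by
  unfold EE
  rw [Finset.powersetCard_eq_empty.2 (by simp)]; simp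

lemma EE_upper (w : ℕ → ℝ) (hw : ∀ i, 0 ≤ w i) (S : Finset ℕ) :
    ∀ k : ℕ, ((k:ℝ)+1) * EE w S (k+1) ≤ (∑ i ∈ S, w i) * EE w S k := by
  induction S using Finset.induction_on with
  | empty => intro k; rw [EE_empty]; simp
  | insert a S ha ih =>
    intro k
    rw [EE_insert w S a ha, Finset.sum_insert ha]
    have hx := hw a
    cases k with
    | zero =>
      rw [EE_zero, EE_zero]
      have := ih 0
      rw [EE_zero] at this
      push_cast at *
      linarith
    | succ k =>
      rw [EE_insert w S a ha]
      have h1 := ih (k+1)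
      have h2 := mul_le_mul_of_nonneg_left (ih k) hx
      have h3 := mul_nonneg (mul_nonneg hx hx) (EE_nonneg w hw S k)
      push_cast at *
      nlinarith

lemma EE_one (w : ℕ → ℝ) (S : Finset ℕ) : EE w S 1 = ∑ i ∈ S, w i := by
  simp [EE, Finset.powersetCard_one]

lemma EE_lower (w : ℕ → ℝ) (hw : ∀ i, 0 ≤ w i) (S : Finset ℕ) :
    ∀ k : ℕ, (∑ i ∈ S, w i) * EE w S (k+1) - (∑ i ∈ S, w i ^ 2) * EE w S k ≤
      ((k:ℝ)+2) * EE w S (k+2) := by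
  induction S using Finset.induction_on with
  | empty => intro k; rw [EE_empty]; simp [EE_empty]
  | insert a S ha ih =>
    intro k
    rw [EE_insert w S a ha, EE_insert w S a ha, Finset.sum_insert ha, Finset.sum_insert ha]
    have hx := hw a
    cases k with
    | zero =>
      rw [EE_zero, EE_zero]
      have := ih 0
      rw [EE_zero] at this
      simp only [zero_add] at *
      rw [EE_one] at *
      push_cast at *
      nlinarith
    | succ k =>
      rw [EE_insert w S a ha]
      have h1 := ih (k+1)
      have h2 := mul_le_mul_of_nonneg_left (ih k) hx
      have h3 := mul_nonneg (mul_nonneg hx (mul_nonneg hx hx)) (EE_nonneg w hw S k)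
      push_cast at *
      nlinarith

lemma EE_le (w : ℕ → ℝ) (hw : ∀ i, 0 ≤ w i) (S : Finset ℕ) (k : ℕ) :
    (k.factorial : ℝ) * EE w S k ≤ (∑ i ∈ S, w i) ^ k := by
  have hL : 0 ≤ ∑ i ∈ S, w i := Finset.sum_nonneg (fun i _ => hw i)
  induction k with
  | zero => simp [EE_zero]
  | succ k ih =>
    rw [Nat.factorial_succ, pow_succ]
    have h1 := mul_le_mul_of_nonneg_left (EE_upper w hw S k) (show (0:ℝ) ≤ k.factorial by positivity)
    have h2 := mul_le_mul_of_nonneg_left ih hL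
    push_cast
    nlinarith

lemma EE_ge (w : ℕ → ℝ) (hw : ∀ i, 0 ≤ w i) (S : Finset ℕ) (k : ℕ) :
    (∑ i ∈ S, w i) ^ k * ((∑ i ∈ S, w i) ^ 2 - (∑ i ∈ S, w i ^ 2) * ((k:ℝ) * (k-1) / 2)) ≤
      (∑ i ∈ S, w i) ^ 2 * ((k.factorial : ℝ) * EE w S k) := by
  have hL : 0 ≤ ∑ i ∈ S, w i := Finset.sum_nonneg (fun i _ => hw i)
  have hs : 0 ≤ ∑ i ∈ S, w i ^ 2 := Finset.sum_nonneg (fun i _ => sq_nonneg _)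
  induction k with
  | zero => simp [EE_zero]
  | succ k ih =>
    cases k with
    | zero => simp [EE_one]; linarith
    | succ k =>
      have h1 := EE_lower w hw S k
      have h2 := EE_le w hw S k
      set L := ∑ i ∈ S, w i
      set s := ∑ i ∈ S, w i ^ 2
      have f1 : ((k+1+1).factorial : ℝ) = (k+2) * (k+1) * k.factorial := by
        rw [Nat.factorial_succ, Nat.factorial_succ]; push_cast; ring
      have f2 : ((k+1).factorial : ℝ) = (k+1) * k.factorial := by
        rw [Nat.factorial_succ]; push_cast; ring
      rw [f1]
      rw [f2] at ih
      set f : ℝ := (k.factorial : ℝ)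
      have hf : 0 ≤ f := by positivity
      have h3 := mul_le_mul_of_nonneg_left h1 (show 0 ≤ L^2 * (k+1) * f by positivity)
      have h4 := mul_le_mul_of_nonneg_left h2 (show 0 ≤ L^2 * (k+1) * s by positivity)
      have h5 := mul_le_mul_of_nonneg_left ih hL
      push_cast at *
      have e1 : L ^ 2 * (((k:ℝ) + 2) * (k+1) * f * EE w S (k+1+1)) = L^2 * (k+1) * f * ((k+2) * EE w S (k+2)) := by ring
      rw [e1]
      refine le_trans ?_ h3
      have e2 : L ^ (k+1+1) * (L^2 - s * (((k:ℝ)+1+1) * (k+1+1-1) / 2)) =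
        L * (L ^ (k+1) * (L^2 - s * (((k:ℝ)+1) * (k+1-1) / 2))) - L^2 * (k+1) * s * L ^ k := by ring
      rw [e2]
      nlinarith

lemma primeProd_eq (y x : ℝ) : primeProd y x = ∏ p ∈ PS y x, ((1:ℝ) + 1 / p)⁻¹ := by
  unfold primeProd
  have : {p : ℕ | p.Prime ∧ y ≤ (p : ℝ) ∧ (p : ℝ) < x} = (PS y x : Set ℕ) := by
    ext p
    rw [Finset.mem_coe, mem_PS]; rfl
  rw [this, finprod_mem_coe_finset]

lemma finsum_eq (y x : ℝ) (k : ℕ) :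
    ∑ᶠ n ∈ {n | n ∈ Sset y x ∧ omegaN n = k}, ((n : ℝ))⁻¹ = EE (fun p => 1 / (p:ℝ)) (PS y x) k := by
  have hpr : ∀ A ∈ (PS y x).powersetCard k, ∀ p ∈ A, p.Prime := fun A hA p hp =>
    (mem_PS.1 ((Finset.mem_powersetCard.1 hA).1 hp)).1
  have hpf : ∀ A ∈ (PS y x).powersetCard k, (∏ p ∈ A, p).primeFactors = A := fun A hA =>
    Nat.primeFactors_prod (hpr A hA)
  have : {n | n ∈ Sset y x ∧ omegaN n = k} =
      (((PS y x).powersetCard k).image (fun A => ∏ p ∈ A, p) : Finset ℕ) := by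
    ext n
    simp only [Set.mem_ofPred_eq, Finset.coe_image, Set.mem_image, Finset.mem_coe, Sset, omegaN]
    constructor
    · rintro ⟨⟨h0, hs, hp⟩, hk⟩
      refine ⟨n.primeFactors, ?_, Nat.prod_primeFactors_of_squarefree hs⟩
      rw [Finset.mem_powersetCard]
      refine ⟨fun p hpn => mem_PS.2 ⟨Nat.prime_of_mem_primeFactors hpn, hp p hpn⟩, hk⟩
    · rintro ⟨A, hA, rfl⟩
      rw [hpf A hA]
      refine ⟨⟨Finset.prod_pos (fun p hp => (hpr A hA p hp).pos), ?_, ?_⟩, (Finset.mem_powersetCard.1 hA).2⟩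
      · apply Finset.squarefree_prod_of_pairwise_isCoprime
        · intro p hp q hq hpq
          simp only [Function.onFun]
          rw [← Nat.coprime_iff_isRelPrime]
          exact (Nat.coprime_primes (hpr A hA p hp) (hpr A hA q hq)).2 hpq
        · exact fun p hp => (hpr A hA p hp).prime.squarefree
      · intro p hp
        exact (mem_PS.1 ((Finset.mem_powersetCard.1 hA).1 hp)).2
  rw [this, finsum_mem_coe_finset, Finset.sum_image]
  · unfold EE
    apply Finset.sum_congr rfl
    intro A hA
    push_cast
    simp
  · intro A hA B hB h
    rw [← hpf A hA, ← hpf B hB]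
    exact congrArg _ h

lemma sq_sum_le (y x : ℝ) (K : ℕ) (h : (K:ℝ) < y) :
    ∑ p ∈ PS y x, (1 / (p:ℝ)) ^ 2 ≤ 2 / ((K:ℝ) + 1) := by
  refine le_trans ?_ (sum_Ioo_inv_sq_le (α := ℝ) K ⌈x⌉₊)
  have : ∀ p : ℕ, (1 / (p:ℝ)) ^ 2 = ((p:ℝ)^2)⁻¹ := fun p => by simp
  simp_rw [this]
  apply Finset.sum_le_sum_of_subset_of_nonneg
  · intro p hp
    have h1 := mem_PS.1 hp
    rw [Finset.mem_Ioo]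
    constructor
    · have : (K:ℝ) < p := by linarith [h1.2.1]
      exact_mod_cast this
    · exact Nat.lt_ceil.2 h1.2.2
  · intros; positivity

lemma primeProd_lower (y x : ℝ) : Real.exp (-LS y x) ≤ primeProd y x := by
  rw [primeProd_eq, LS, ← Finset.sum_neg_distrib, Real.exp_sum]
  apply Finset.prod_le_prod (fun _ _ => (Real.exp_pos _).le)
  intro p _
  rw [Real.exp_neg]
  have : (0:ℝ) ≤ 1 / p := by positivity
  apply inv_anti₀ (by linarith)
  have := Real.add_one_le_exp (1 / (p:ℝ))
  linarith

lemma primeProd_upper (y x : ℝ) (hy : 1 ≤ y) : primeProd y x ≤ Real.exp (-LS y x + 2) := by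
  have h2 := sq_sum_le y x 0 (by simp; linarith)
  have : primeProd y x ≤ Real.exp (∑ p ∈ PS y x, (-(1 / (p:ℝ)) + (1 / (p:ℝ))^2)) := by
    rw [primeProd_eq, Real.exp_sum]
    apply Finset.prod_le_prod (fun _ _ => by positivity)
    intro p _
    have h0 : (0:ℝ) ≤ 1 / p := by positivity
    set u := (1:ℝ)/p
    have h1 := Real.add_one_le_exp (-u + u^2)
    refine le_trans ?_ h1
    rw [inv_le_iff_one_le_mul₀ (by linarith)]
    have : (-u + u^2 + 1) * (1 + u) = 1 + u^3 := by ring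
    rw [this]
    have := pow_nonneg h0 3
    linarith
  refine this.trans (Real.exp_le_exp.2 ?_)
  rw [Finset.sum_add_distrib, Finset.sum_neg_distrib]
  unfold LS
  simp at h2 ⊢
  linarith

lemma main_term (D : ℝ) (hD : 0 < D) (k : ℕ) (hk : 0 < k) :
    Real.exp (-D * Qfun ((k:ℝ) / D)) / Real.sqrt k ≤ 3 * (Real.exp (-D) * D ^ k / k.factorial) ∧
    Real.exp (-D) * D ^ k / k.factorial ≤ Real.exp (-D * Qfun ((k:ℝ) / D)) / Real.sqrt k := by
  have hk0 : (0:ℝ) < k := by exact_mod_cast hk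
  have hsk : 0 < Real.sqrt k := Real.sqrt_pos.2 hk0
  have e1 : Real.exp (-D * Qfun ((k:ℝ) / D)) = Real.exp (-D) * D ^ k / (k / Real.exp 1) ^ k := by
    unfold Qfun
    have hx : D ^ k = Real.exp (k * Real.log D) := by
      rw [← Real.log_pow, Real.exp_log (by positivity)]
    have hy : ((k:ℝ) / Real.exp 1) ^ k = Real.exp (k * Real.log k - k) := by
      rw [← Real.exp_log (x := ((k:ℝ) / Real.exp 1) ^ k) (by positivity), Real.log_pow,
        Real.log_div hk0.ne' (Real.exp_pos _).ne', Real.log_exp]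
      congr 1; ring
    rw [hx, hy, ← Real.exp_add, ← Real.exp_sub, Real.log_div hk0.ne' hD.ne']
    congr 1
    field_simp
    ring
  set F : ℝ := ((k:ℝ) / Real.exp 1) ^ k
  have hF : 0 < F := by positivity
  have hfac : (0:ℝ) < k.factorial := by positivity
  have u1 : Real.sqrt k * F ≤ k.factorial := by
    refine le_trans ?_ (Stirling.le_factorial_stirling k)
    gcongr
    have := Real.pi_gt_three
    nlinarith
  have u2 : (k.factorial : ℝ) ≤ 3 * (Real.sqrt k * F) := by
    obtain ⟨m, rfl⟩ : ∃ m, k = m + 1 := ⟨k - 1, by omega⟩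
    have h1 := Stirling.stirlingSeq'_antitone (Nat.zero_le m)
    simp only [Function.comp, Nat.succ_eq_add_one, zero_add] at h1
    rw [Stirling.stirlingSeq_one] at h1
    unfold Stirling.stirlingSeq at h1
    rw [div_le_iff₀ (by positivity)] at h1
    refine h1.trans ?_
    rw [Real.sqrt_mul (by norm_num)]
    have h2 : (0:ℝ) < Real.sqrt 2 := by positivity
    have : Real.exp 1 / Real.sqrt 2 * (Real.sqrt 2 * Real.sqrt ((m+1:ℕ):ℝ) * (((m+1:ℕ):ℝ) / Real.exp 1) ^ (m+1)) = Real.exp 1 * (Real.sqrt ((m+1:ℕ):ℝ) * F) := by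
      field_simp
      rfl
    rw [this]
    gcongr
    have := Real.exp_one_lt_d9
    linarith
  rw [e1]
  set N := Real.exp (-D) * D ^ k
  have hN : 0 < N := by positivity
  rw [div_div, ← mul_div_assoc]
  constructor
  · rw [div_le_div_iff₀ (by positivity) hfac]
    nlinarith
  · apply div_le_div_of_nonneg_left hN.le (by positivity)
    linarith

lemma LLog2_big (x : ℝ) (hx : 16 ≤ x) : LLog2 x = Real.log (Real.log x) ∧ 1 ≤ Real.log (Real.log x) := by
  have h2 : Real.exp 1 ≤ Real.log x := by
    have h1 : Real.exp 1 < 2.7182818286 := Real.exp_one_lt_d9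
    have h3 : (0.6931471803:ℝ) < Real.log 2 := Real.log_two_gt_d9
    have h4 : Real.log 16 = 4 * Real.log 2 := by
      rw [show (16:ℝ) = 2 ^ 4 by norm_num, Real.log_pow]; norm_num
    have h5 : Real.log 16 ≤ Real.log x := Real.log_le_log (by norm_num) hx
    linarith
  have h3 : 1 ≤ Real.log (Real.log x) := by
    rw [Real.le_log_iff_exp_le (by linarith [Real.exp_pos 1])]; exact h2
  have h4 : 1 ≤ Real.log x := by linarith [Real.add_one_le_exp (1:ℝ)]
  refine ⟨?_, h3⟩
  unfold LLog2 LLog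
  rw [max_eq_right h4, max_eq_right h3]

lemma LLog2_ge (x : ℝ) : 1 ≤ LLog2 x := le_max_left _ _

lemma LLog2_mono {x y : ℝ} (hx : 0 < x) (h : x ≤ y) : LLog2 x ≤ LLog2 y := by
  have hp : 1 ≤ LLog x := le_max_left _ _
  have h1 : LLog x ≤ LLog y := max_le_max le_rfl (Real.log_le_log hx h)
  exact max_le_max le_rfl (Real.log_le_log (by linarith) h1)

lemma LS_bound : ∃ C : ℝ, 0 < C ∧ ∀ x y : ℝ, 16 ≤ x → 1 ≤ y → y ≤ x →
    |LS y x - (LLog2 x - LLog2 y)| ≤ C := by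
  obtain ⟨C, hC, h⟩ := mertens2
  have h16 := LLog2_ge 16
  have hl16 : 1 ≤ Real.log 16 := by
    rw [Real.le_log_iff_exp_le (by norm_num)]
    linarith [Real.exp_one_lt_d9]
  have main : ∀ x y : ℝ, 16 ≤ y → y ≤ x → |LS y x - (LLog2 x - LLog2 y)| ≤ C := by
    intro x y hy hyx
    rw [(LLog2_big x (by linarith)).1, (LLog2_big y hy).1]
    refine (h y x (by linarith) hyx).trans ?_
    have : Real.log 16 ≤ Real.log y := Real.log_le_log (by norm_num) hy
    rw [div_le_iff₀ (by linarith)]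
    nlinarith
  refine ⟨C + LS 1 16 + LLog2 16, by linarith [LS_nonneg 1 16], ?_⟩
  intro x y hx hy hyx
  rcases le_total 16 y with h1 | h1
  · have := main x y h1 hyx
    linarith [LS_nonneg 1 16]
  · have h2 := abs_le.1 (main x 16 le_rfl hx)
    have h3 := LS_add h1 hx
    have h4 := LS_add hy h1
    have h5 := LS_nonneg 1 y
    have h6 := LS_nonneg y 16
    have h7 := LLog2_mono (by linarith) h1
    have h8 := LLog2_ge y
    rw [abs_le]
    constructor <;> linarith

lemma LS_lower : ∃ d Y X : ℝ, 0 < d ∧ 801 ≤ Y ∧ ∀ x y : ℝ, X ≤ x → 1 ≤ y → y ≤ x →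
    1/10 ≤ LLog2 x - LLog2 y →
    LLog2 x - LLog2 y - d ≤ LS (max y Y) x ∧ (LLog2 x - LLog2 y) / 2 ≤ LS (max y Y) x := by
  obtain ⟨C, hC, h⟩ := mertens2
  set Y := max 801 (Real.exp (40 * C)) with hY
  have hY1 : 801 ≤ Y := le_max_left _ _
  have hY2 : 40 * C ≤ Real.log Y := by
    rw [Real.le_log_iff_exp_le (by linarith)]; exact le_max_right _ _
  have main : ∀ x y : ℝ, Y ≤ y → y ≤ x → LLog2 x - LLog2 y - 1/40 ≤ LS y x := by
    intro x y hy hyx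
    rw [(LLog2_big x (by linarith)).1, (LLog2_big y (by linarith)).1]
    have h1 := abs_le.1 (h y x (by linarith) hyx)
    have h2 : Real.log Y ≤ Real.log y := Real.log_le_log (by linarith) hy
    have h3 : C / Real.log y ≤ 1/40 := by
      rw [div_le_iff₀ (by linarith)]
      linarith
    linarith
  have h1Y := LLog2_ge Y
  refine ⟨LLog2 Y, Y, max Y (Real.exp (Real.exp (3 * LLog2 Y + 1))), by linarith, hY1, ?_⟩
  intro x y hx hy hyx hD
  have hxY : Y ≤ x := (le_max_left _ _).trans hx
  have hx2 : 3 * LLog2 Y + 1 ≤ LLog2 x := by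
    rw [(LLog2_big x (by linarith)).1]
    have h1 : Real.exp (Real.exp (3 * LLog2 Y + 1)) ≤ x := (le_max_right _ _).trans hx
    have h2 := (Real.le_log_iff_exp_le (by linarith)).2 h1
    exact (Real.le_log_iff_exp_le (by linarith [Real.exp_pos (3 * LLog2 Y + 1)])).2 h2
  rcases le_total Y y with h1 | h1
  · rw [max_eq_left h1]
    have := main x y h1 hyx
    constructor <;> linarith
  · rw [max_eq_right h1]
    have := main x Y le_rfl hxY
    have h2 := LLog2_ge y
    have h3 := LLog2_mono (by linarith) h1
    constructor <;> linarith

lemma EE_mono (w : ℕ → ℝ) (hw : ∀ i, 0 ≤ w i) {S T : Finset ℕ} (h : S ⊆ T) (k : ℕ) :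
    EE w S k ≤ EE w T k :=
  Finset.sum_le_sum_of_subset_of_nonneg (Finset.powersetCard_mono h)
    (fun _ _ _ => Finset.prod_nonneg (fun i _ => hw i))

set_option maxHeartbeats 2000000 in
theorem statement4 :
    ∃ c₁ c₂ x₀ : ℝ, 0 < c₁ ∧ c₁ < c₂ ∧
      ∀ x y : ℝ, ∀ k : ℕ, x₀ ≤ x → 1 ≤ y → y ≤ x → 0 < k →
        (k : ℝ) ≤ 10 * (LLog2 x - LLog2 y) →
        c₁ * Real.exp (-(LLog2 x - LLog2 y) * Qfun ((k : ℝ) / (LLog2 x - LLog2 y)))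
              / Real.sqrt k
            ≤ primeProd y x * ∑ᶠ n ∈ {n | n ∈ Sset y x ∧ omegaN n = k}, ((n : ℝ))⁻¹ ∧
          primeProd y x * ∑ᶠ n ∈ {n | n ∈ Sset y x ∧ omegaN n = k}, ((n : ℝ))⁻¹
            ≤ c₂ * Real.exp (-(LLog2 x - LLog2 y) * Qfun ((k : ℝ) / (LLog2 x - LLog2 y)))
              / Real.sqrt k := by
  obtain ⟨C, hC, hLS⟩ := LS_bound
  obtain ⟨d, Y, X, hd, hY, hlow⟩ := LS_lower
  refine ⟨Real.exp (-20 * d - C) / 6, Real.exp (11 * C + 2), max X 16, by positivity, ?_, ?_⟩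
  · have h1 : Real.exp (-20 * d - C) ≤ 1 := Real.exp_le_one_iff.2 (by linarith)
    have h2 : 1 ≤ Real.exp (11 * C + 2) := Real.one_le_exp (by linarith)
    linarith
  intro x y k hx hy hyx hk hkD
  have hxX : X ≤ x := (le_max_left _ _).trans hx
  have hx16 : 16 ≤ x := (le_max_right _ _).trans hx
  have hL := abs_le.1 (hLS x y hx16 hy hyx)
  have hk1 : (1:ℝ) ≤ k := by exact_mod_cast hk
  have hLl := hlow x y hxX hy hyx (by linarith)
  set D := LLog2 x - LLog2 y with hDdef
  have hD : 0 < D := by linarith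
  obtain ⟨m1, m2⟩ := main_term D hD k hk
  rw [finsum_eq]
  set w : ℕ → ℝ := fun p => 1 / (p:ℝ) with hw_def
  have hw : ∀ i, 0 ≤ w i := fun i => by simp only [hw_def]; positivity
  have hfac : (0:ℝ) < k.factorial := by positivity
  have hE0 := EE_nonneg w hw (PS y x) k
  have hkD' : (k:ℝ) / D ≤ 10 := by rw [div_le_iff₀ hD]; exact hkD
  rw [mul_div_assoc, mul_div_assoc]
  set M := Real.exp (-D * Qfun ((k:ℝ) / D)) / Real.sqrt k
  constructor
  · -- lower bound
    set S := PS (max y Y) x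
    have hS : S ⊆ PS y x := by
      intro p hp
      have := mem_PS.1 hp
      exact mem_PS.2 ⟨this.1, (le_max_left _ _).trans this.2.1, this.2.2⟩
    have hmono := EE_mono w hw hS k
    have hge := EE_ge w hw S k
    have hs2 : ∑ i ∈ S, w i ^ 2 ≤ 1/400 := by
      have := sq_sum_le (max y Y) x 800 (by
        have := le_max_right y Y
        push_cast
        linarith)
      refine this.trans ?_
      norm_num
    have hs0 : 0 ≤ ∑ i ∈ S, w i ^ 2 := Finset.sum_nonneg (fun i _ => sq_nonneg _)
    have hLdef : ∑ i ∈ S, w i = LS (max y Y) x := rfl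
    rw [hLdef] at hge
    set L := LS (max y Y) x
    set s := ∑ i ∈ S, w i ^ 2
    obtain ⟨l1, l2⟩ := hLl
    have hL0 : 0 < L := by linarith
    have hfe : L ^ k / 2 ≤ k.factorial * EE w S k := by
      have h1 : s * ((k:ℝ) * (k-1) / 2) ≤ L ^ 2 / 2 := by
        have a1 : (k:ℝ) * (k-1) / 2 ≤ 200 * L ^ 2 := by nlinarith
        have a2 : 0 ≤ (k:ℝ) * (k-1) / 2 := by
          have : 0 ≤ (k:ℝ) - 1 := by linarith
          positivity
        calc s * ((k:ℝ) * (k-1) / 2) ≤ 1/400 * (200 * L^2) := by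
              apply mul_le_mul hs2 a1 a2 (by norm_num)
          _ = _ := by ring
      have h2 : L ^ k * (L ^ 2 / 2) ≤ L ^ 2 * (k.factorial * EE w S k) := by
        refine le_trans ?_ hge
        apply mul_le_mul_of_nonneg_left _ (by positivity)
        linarith
      have h3 : L ^ 2 * (L ^ k / 2) ≤ L ^ 2 * (k.factorial * EE w S k) := by
        refine le_trans (le_of_eq ?_) h2; ring
      exact le_of_mul_le_mul_left h3 (by positivity)
    have hLk : D ^ k * Real.exp (-20 * d) ≤ L ^ k := by
      have h1 : D * Real.exp (-(2 * d / D)) ≤ L := by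
        rcases le_total D L with h | h
        · have : Real.exp (-(2 * d / D)) ≤ 1 := Real.exp_le_one_iff.2 (by
            have : 0 ≤ 2 * d / D := by positivity
            linarith)
          nlinarith
        · have a1 := Real.log_le_sub_one_of_pos (x := D / L) (by positivity)
          have a2 : D / L - 1 ≤ 2 * d / D := by
            have : D / L - 1 = (D - L) / L := by field_simp
            rw [this, div_le_div_iff₀ hL0 hD]
            nlinarith
          have a3 : D / L ≤ Real.exp (2 * d / D) := by
            rw [← Real.log_le_iff_le_exp (by positivity)]; linarith
          rw [Real.exp_neg, ← div_eq_mul_inv, div_le_iff₀ (Real.exp_pos _)]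
          rw [div_le_iff₀ hL0] at a3
          linarith
      have h2 := pow_le_pow_left₀ (by positivity) h1 k
      rw [mul_pow, ← Real.exp_nat_mul] at h2
      refine le_trans ?_ h2
      apply mul_le_mul_of_nonneg_left _ (by positivity)
      apply Real.exp_le_exp.2
      have : (k:ℝ) * -(2 * d / D) = -(2 * d * (k / D)) := by ring
      rw [this]
      nlinarith
    have hpp : Real.exp (-D - C) ≤ primeProd y x := by
      refine le_trans (Real.exp_le_exp.2 ?_) (primeProd_lower y x)
      linarith
    have hE : D ^ k * Real.exp (-20 * d) / 2 / k.factorial ≤ EE w (PS y x) k := by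
      rw [div_le_iff₀ hfac]
      nlinarith
    calc Real.exp (-20 * d - C) / 6 * M
        ≤ Real.exp (-20 * d - C) / 6 * (3 * (Real.exp (-D) * D ^ k / k.factorial)) := by gcongr
      _ = Real.exp (-D - C) * (D ^ k * Real.exp (-20 * d) / 2 / k.factorial) := by
          rw [Real.exp_sub (-20 * d), Real.exp_sub (-D)]; ring
      _ ≤ _ := mul_le_mul hpp hE (by positivity) ((Real.exp_pos _).le.trans hpp)
  · -- upper bound
    have hle := EE_le w hw (PS y x) k
    have hLdef : ∑ i ∈ PS y x, w i = LS y x := rfl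
    rw [hLdef] at hle
    have hL0 := LS_nonneg y x
    set L := LS y x
    have hLk : L ^ k ≤ D ^ k * Real.exp (10 * C) := by
      have h1 : L ≤ D * Real.exp (C / D) := by
        have := mul_le_mul_of_nonneg_left (Real.add_one_le_exp (C / D)) hD.le
        have e : D * (C / D + 1) = C + D := by field_simp
        linarith
      have h2 := pow_le_pow_left₀ hL0 h1 k
      rw [mul_pow, ← Real.exp_nat_mul] at h2
      refine h2.trans ?_
      apply mul_le_mul_of_nonneg_left _ (by positivity)
      apply Real.exp_le_exp.2
      have : (k:ℝ) * (C / D) = C * (k / D) := by ring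
      rw [this]
      nlinarith
    have hpp : primeProd y x ≤ Real.exp (-D + C + 2) := by
      refine (primeProd_upper y x hy).trans (Real.exp_le_exp.2 ?_)
      linarith
    have hE : EE w (PS y x) k ≤ D ^ k * Real.exp (10 * C) / k.factorial := by
      rw [le_div_iff₀ hfac]
      linarith
    calc primeProd y x * EE w (PS y x) k
        ≤ Real.exp (-D + C + 2) * (D ^ k * Real.exp (10 * C) / k.factorial) :=
          mul_le_mul hpp hE hE0 (Real.exp_pos _).le
      _ = Real.exp (11 * C + 2) * (Real.exp (-D) * D ^ k / k.factorial) := by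
          have : Real.exp (-D + C + 2) * Real.exp (10 * C) = Real.exp (11 * C + 2) * Real.exp (-D) := by
            rw [← Real.exp_add, ← Real.exp_add]; congr 1; ring
          linear_combination (D ^ k / k.factorial) * this
      _ ≤ _ := by gcongr
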